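/- arXiv:math/0006198 — 9 statements merged into one kernel-verified Lean document; each statement's English description precedes it below -/
import Mathlib

section
/- For every infinite cardinal τ there exists a Tychonoff (completely regular T1) topological space X such that X contains a closed subset F which is discrete in the subspace topology with |F| ≥ τ, and yet X has countable weak extent, i.e., for every open cover 𝒰 of X there exists a countable set A ⊆ X with St(A,𝒰) = X. -/
open Set Cardinal

universe u

open Filter Topology

/-- The set of points reachable from a point along a relation with countable outdegrees is
countable. -/
theorem countable_setOf_reflTransGen {α : Type*} {r : α → α → Prop}
    (hr : ∀ x, {y | r x y}.Countable) (x : α) : {y | Relation.ReflTransGen r x y}.Countable := by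
  let G : ℕ → Set α := fun n => Nat.rec {x} (fun _ s => ⋃ a ∈ s, {y | r a y}) n
  have hG : ∀ n, (G n).Countable := by
    intro n
    induction n with
    | zero => exact countable_singleton x
    | succ n ih => exact ih.biUnion fun a _ => hr a
  refine (countable_iUnion hG).mono fun y hy => ?_
  induction (show Relation.ReflTransGen r x y from hy) with
  | refl => exact mem_iUnion.2 ⟨0, rfl⟩
  | tail hab hbc ih =>
    obtain ⟨n, hn⟩ := mem_iUnion.1 (ih hab)
    exact mem_iUnion.2 ⟨n + 1, mem_iUnion₂.2 ⟨_, hn, hbc⟩⟩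

/-- If `r` is a rank function into a well-order and every point has finitely many neighbours, the
points admit a colouring by natural numbers in which each point avoids the colours of its
neighbours of smaller rank. -/
theorem exists_nat_coloring_of_rank {α β : Type*} [LinearOrder β] [WellFoundedLT β]
    (r : α → β) (F : α → Finset α) :
    ∃ c : α → ℕ, ∀ x, ∀ y ∈ F x, r y < r x → c y ≠ c x := by
  classical
  have wf : WellFounded (fun a b : α => r a < r b) := InvImage.wf r wellFounded_lt
  let step : ∀ x : α, (∀ y, r y < r x → ℕ) → ℕ := fun x g =>
    (Infinite.exists_notMem_finset
      ((F x).image fun y => if h : r y < r x then g y h else 0)).choose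
  refine ⟨wf.fix step, fun x y hy hyx heq => ?_⟩
  have hx : wf.fix step x = step x fun y _ => wf.fix step y := wf.fix_eq step x
  have hnot := (Infinite.exists_notMem_finset
    ((F x).image fun y => if r y < r x then wf.fix step y else 0)).choose_spec
  apply hnot
  refine Finset.mem_image.2 ⟨y, hy, ?_⟩
  rw [if_pos hyx, heq, hx]

/-- A set mapping with finite values has a decomposition of its domain into countably many free
sets. -/
theorem exists_nat_coloring_of_finset_valued {α : Type*} (F : α → Finset α) :
    ∃ c : α → ℕ, ∀ x, ∀ y ∈ F x, y ≠ x → c y ≠ c x := by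
  classical
  obtain ⟨_, _⟩ := exists_wellFoundedLT α
  let R : α → α → Prop := Relation.ReflTransGen fun a b => b ∈ F a
  have hne : ∀ y, {x | R x y}.Nonempty := fun y => ⟨y, Relation.ReflTransGen.refl⟩
  let r : α → α := fun y => wellFounded_lt.min {x | R x y} (hne y)
  have hrR : ∀ y, R (r y) y := fun y => wellFounded_lt.min_mem _ (hne y)
  have hmono : ∀ x, ∀ y ∈ F x, r y ≤ r x := fun x y hy =>
    wellFounded_lt.min_le (s := {a | R a y}) ((hrR x).tail hy)
  have hfib : ∀ a, {y | R a y}.Countable :=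
    countable_setOf_reflTransGen fun x => (F x).countable_toSet
  choose e he using fun a => countable_iff_exists_injOn.1 (hfib a)
  obtain ⟨c, hc⟩ := exists_nat_coloring_of_rank r F
  refine ⟨fun x => Nat.pair (c x) (e (r x) x), fun x y hy hyx heq => ?_⟩
  obtain ⟨h₁, h₂⟩ := Nat.pair_eq_pair.1 heq
  rcases (hmono x y hy).lt_or_eq with h | h
  · exact hc x y hy h h₁
  · rw [h] at h₂
    exact hyx (he (r x) (show R (r x) y from h ▸ hrR y) (hrR x) h₂)

/-- If every sequence in `S` stays in a compact subset of `S`, then every open cover of `S` has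
a finite subset of `S` whose star contains `S`. -/
theorem exists_finite_star_cover {X : Type*} [TopologicalSpace X] {S : Set X}
    (hS : ∀ f : ℕ → X, (∀ n, f n ∈ S) → ∃ K ⊆ S, IsCompact K ∧ ∀ n, f n ∈ K)
    {𝒰 : Set (Set X)} (ho : ∀ U ∈ 𝒰, IsOpen U) (hc : S ⊆ ⋃₀ 𝒰) :
    ∃ A : Set X, A.Finite ∧ S ⊆ ⋃₀ {U ∈ 𝒰 | (U ∩ A).Nonempty} := by
  by_contra! hcon
  obtain ⟨f, hfS, hf⟩ := exists_seq_of_forall_finset_exists (fun x => x ∈ S)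
    (fun x y => ∀ U ∈ 𝒰, x ∈ U → y ∉ U) fun s _ => by
      obtain ⟨y, hyS, hy⟩ := not_subset.1 (hcon s s.finite_toSet)
      exact ⟨y, hyS, fun x hx U hU hxU hyU => hy ⟨U, ⟨hU, x, hxU, hx⟩, hyU⟩⟩
  obtain ⟨K, hKS, hK, hfK⟩ := hS f hfS
  obtain ⟨z, hzK, hz⟩ := hK.exists_mapClusterPt (f := atTop) (u := f)
    (tendsto_principal.2 (Eventually.of_forall hfK))
  obtain ⟨U, hU, hzU⟩ := hc (hKS hzK)
  have hfreq := hz.frequently ((ho U hU).mem_nhds hzU)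
  obtain ⟨m, hm⟩ := hfreq.exists
  obtain ⟨n, hmn, hn⟩ := (frequently_atTop.1 hfreq) (m + 1)
  exact hf m n hmn U hU hm hn

/-- For every infinite cardinal `τ` there is a complete linear order in which families of at most
`τ` points below `⊤` are strictly bounded below `⊤`. -/
theorem exists_completeLinearOrder_forall_bounded (τ : Cardinal.{u}) (hτ : ℵ₀ ≤ τ) :
    ∃ (K : Type u) (_ : CompleteLinearOrder K), ∀ (ι : Type u) (f : ι → K), #ι ≤ τ →
      (∀ i, f i < ⊤) → ∃ b < ⊤, ∀ i, f i < b := by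
  let L := (Order.succ τ).ord.ToType
  have hcof : Order.cof L = Order.succ τ := by
    rw [Ordinal.cof_toType]
    exact (isRegular_succ hτ).cof_ord
  have : Nonempty L := by
    rw [← Order.cof_ne_zero_iff, hcof]
    exact (Order.bot_lt_succ τ).ne'
  let _ : OrderBot L := WellFoundedLT.toOrderBot L
  let _ : ConditionallyCompleteLinearOrderBot L :=
    WellFoundedLT.conditionallyCompleteLinearOrderBot L
  refine ⟨WithTop L, inferInstance, fun ι f hι hf => ?_⟩
  lift f to ι → L using fun i => (hf i).ne
  have hncof : ¬ IsCofinal (range f) := fun h =>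
    ((Order.lt_succ τ).trans_le (hcof ▸ Order.cof_le h)).not_ge (mk_range_le.trans hι)
  simp only [IsCofinal, not_forall, not_exists, not_and, not_le] at hncof
  obtain ⟨b, hb⟩ := hncof
  exact ⟨b, WithTop.coe_lt_top b, fun i => WithTop.coe_lt_coe.2 (hb _ (mem_range_self i))⟩

section Plank

variable {I K : Type u} [DecidableEq I] [CompleteLinearOrder K]

variable (I K) in
/-- The subspace of `2^I × K` consisting of `2^I × {t | t < ⊤}` together with the points `(e, ⊤)`
where `e` is the indicator function of a singleton. -/
abbrev CantorPlank : Type u :=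
  {p : (I → Bool) × K // p.2 < ⊤ ∨ ∃ i, p.1 = fun j => decide (j = i)}

/-- The point of the top edge determined by the singleton `{i}`. -/
def CantorPlank.edge (i : I) : CantorPlank I K :=
  ⟨(fun j => decide (j = i), ⊤), Or.inr ⟨i, rfl⟩⟩

theorem CantorPlank.edge_injective :
    Function.Injective (CantorPlank.edge : I → CantorPlank I K) := by
  intro i j h
  have := congrFun (congrArg (fun p => p.1.1) h) i
  simpa [CantorPlank.edge] using this

theorem CantorPlank.range_edge :
    range (CantorPlank.edge : I → CantorPlank I K) = {p | p.1.2 = ⊤} := by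
  ext p
  constructor
  · rintro ⟨i, rfl⟩
    rfl
  · intro hp
    rcases p with ⟨⟨x, t⟩, h⟩
    obtain rfl : t = ⊤ := hp
    obtain h' | ⟨i, hi⟩ := h
    · exact absurd h' (lt_irrefl _)
    · exact ⟨i, Subtype.ext (Prod.ext hi.symm rfl)⟩

variable [TopologicalSpace K]

theorem CantorPlank.discreteTopology_range_edge :
    DiscreteTopology (range (CantorPlank.edge : I → CantorPlank I K)) := by
  refine discreteTopology_iff_isOpen_singleton.2 ?_
  rintro ⟨_, i, rfl⟩
  have hcont : Continuous fun p : range (CantorPlank.edge : I → CantorPlank I K) =>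
      p.1.1.1 i := by fun_prop
  convert (isOpen_discrete {true}).preimage hcont
  ext ⟨_, j, rfl⟩
  rw [mem_singleton_iff, Subtype.ext_iff]
  refine CantorPlank.edge_injective.eq_iff.trans ?_
  simp [CantorPlank.edge, eq_comm]

variable [OrderTopology K]

theorem CantorPlank.isClosed_range_edge :
    IsClosed (range (CantorPlank.edge : I → CantorPlank I K)) := by
  rw [CantorPlank.range_edge]
  exact isClosed_singleton.preimage (continuous_snd.comp continuous_subtype_val)

/-- An open set containing an edge point contains all points of the plank that are high enough and
agree with the edge point on a suitable finite set of coordinates. -/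
theorem CantorPlank.exists_basic_subset (hK : ∃ t : K, t < ⊤) (i : I) {U : Set (CantorPlank I K)}
    (hU : IsOpen U) (hi : CantorPlank.edge i ∈ U) :
    ∃ (F : Finset I) (b : K), b < ⊤ ∧ ∀ p : CantorPlank I K,
      (∀ j ∈ F, p.1.1 j = decide (j = i)) → b < p.1.2 → p ∈ U := by
  obtain ⟨V, hV, rfl⟩ := isOpen_induced_iff.1 hU
  obtain ⟨A, B, hA, hB, hiA, htB, hAB⟩ := isOpen_prod_iff.1 hV _ _ hi
  obtain ⟨F, u, hu, huA⟩ := isOpen_pi_iff.1 hA _ hiA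
  obtain ⟨b, hb, hbB⟩ := exists_Ioc_subset_of_mem_nhds (hB.mem_nhds htB) hK
  refine ⟨F, b, hb, fun p hpF hpb => hAB ⟨huA fun j hj => ?_, hbB ⟨hpb, le_top⟩⟩⟩
  rw [hpF j hj]
  exact (hu j hj).2

theorem CantorPlank.exists_countable_star_cover [Infinite I] (hbot : ∃ t : K, t < ⊤)
    (hK : ∀ f : I → K, (∀ i, f i < ⊤) → ∃ b < ⊤, ∀ i, f i < b)
    {𝒰 : Set (Set (CantorPlank I K))} (ho : ∀ U ∈ 𝒰, IsOpen U) (hc : ⋃₀ 𝒰 = Set.univ) :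
    ∃ A : Set (CantorPlank I K), A.Countable ∧ ⋃₀ {U ∈ 𝒰 | (U ∩ A).Nonempty} = Set.univ := by
  have hseq : ∀ f : ℕ → CantorPlank I K, (∀ n, f n ∈ {p : CantorPlank I K | p.1.2 < ⊤}) →
      ∃ C ⊆ {p : CantorPlank I K | p.1.2 < ⊤}, IsCompact C ∧ ∀ n, f n ∈ C := by
    intro f hf
    obtain ⟨b, hb, hfb⟩ := hK
      (fun i => (f (Function.invFun (Infinite.natEmbedding I) i)).1.2) fun i => hf _
    refine ⟨{p | p.1.2 ≤ b}, fun p hp => lt_of_le_of_lt hp hb, ?_, fun n => ?_⟩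
    · rw [Subtype.isCompact_iff]
      convert (isCompact_univ (X := I → Bool)).prod (isClosed_Iic (a := b)).isCompact
      ext p
      simp only [mem_image, mem_ofPred_eq, mem_prod, mem_univ, true_and, mem_Iic]
      exact ⟨fun ⟨q, hq, hqp⟩ => hqp ▸ hq,
        fun hp => ⟨⟨p, Or.inl (hp.trans_lt hb)⟩, hp, rfl⟩⟩
    · have := hfb (Infinite.natEmbedding I n)
      rw [Function.leftInverse_invFun (Infinite.natEmbedding I).injective] at this
      exact this.le
  obtain ⟨A, hA, hAS⟩ := exists_finite_star_cover hseq ho (hc ▸ subset_univ _)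
  have hcov : ∀ i : I, ∃ U ∈ 𝒰, CantorPlank.edge i ∈ U := fun i =>
    mem_sUnion.1 (hc ▸ mem_univ (CantorPlank.edge i))
  choose U hU𝒰 hiU using hcov
  choose F b hb hFb using fun i =>
    CantorPlank.exists_basic_subset hbot i (ho _ (hU𝒰 i)) (hiU i)
  obtain ⟨c, hcF⟩ := exists_nat_coloring_of_finset_valued F
  obtain ⟨t, ht, hbt⟩ := hK b hb
  let q : ℕ → CantorPlank I K := fun n => ⟨(fun j => decide (c j = n), t), Or.inl ht⟩
  refine ⟨A ∪ range q, hA.countable.union (countable_range q), eq_univ_of_forall fun p => ?_⟩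
  by_cases hp : p.1.2 < ⊤
  · obtain ⟨V, ⟨hV, hVA⟩, hpV⟩ := hAS hp
    exact ⟨V, ⟨hV, hVA.mono (inter_subset_inter_right _ subset_union_left)⟩, hpV⟩
  · obtain ⟨i, rfl⟩ : p ∈ range (CantorPlank.edge : I → CantorPlank I K) := by
      rw [CantorPlank.range_edge]
      exact not_lt_top_iff.1 hp
    refine ⟨U i, ⟨hU𝒰 i, q (c i), hFb i _ (fun j hj => ?_) (hbt i), Or.inr ⟨_, rfl⟩⟩, hiU i⟩
    by_cases hji : j = i
    · simp [q, hji]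
    · simp [q, hji, hcF i j hj hji]

end Plank

/-- For every infinite cardinal `τ` there is a Tychonoff (completely regular T1) space `X`
containing a closed discrete subset of cardinality at least `τ`, while `X` has countable
weak extent: every open cover `𝒰` admits a countable `A` with `St(A, 𝒰) = X`. -/
theorem extent_can_be_big_with_countable_weak_extent (τ : Cardinal.{u}) (hτ : ℵ₀ ≤ τ) :
    ∃ (X : Type u) (_ : TopologicalSpace X), T1Space X ∧ CompletelyRegularSpace X ∧
      (∃ F : Set X, IsClosed F ∧ DiscreteTopology F ∧ τ ≤ #F) ∧
      (∀ 𝒰 : Set (Set X), (∀ U ∈ 𝒰, IsOpen U) → ⋃₀ 𝒰 = Set.univ →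
        ∃ A : Set X, A.Countable ∧ ⋃₀ {U ∈ 𝒰 | (U ∩ A).Nonempty} = Set.univ) := by
  classical
  obtain ⟨K, _, hK⟩ := exists_completeLinearOrder_forall_bounded τ hτ
  let _ : TopologicalSpace K := Preorder.topology K
  have : OrderTopology K := ⟨rfl⟩
  have : Infinite τ.out := by rwa [Cardinal.infinite_iff, mk_out]
  refine ⟨CantorPlank τ.out K, inferInstance, inferInstance, inferInstance,
    ⟨range CantorPlank.edge, CantorPlank.isClosed_range_edge,
      CantorPlank.discreteTopology_range_edge, ?_⟩,
    fun 𝒰 ho hc => CantorPlank.exists_countable_star_cover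
      ((hK PEmpty PEmpty.elim (by simp) (by simp)).imp fun _ h => h.1)
      (fun f hf => hK _ f (mk_out τ).le hf) ho hc⟩
  rw [mk_range_eq _ CantorPlank.edge_injective, mk_out]
end

section
/- (Fodor's free set theorem, order ω case) Let S be a set and let f be a set mapping on S of order ω, i.e., f assigns to each s ∈ S a finite subset f(s) ⊆ S with s ∉ f(s). Then there is a countable family {H_n : n ∈ ℕ} of f-free subsets of S whose union is all of S. -/
open Set

universe u

namespace SetMapping

open Finset in
/-- If a set mapping has values of size at most `n`, then some element of any nonempty finite
set belongs to at most `n` of the values at points of that set. -/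
lemma exists_card_filter_mem_le {S : Type*} [DecidableEq S] {n : ℕ} (F : S → Finset S)
    (hcard : ∀ s, #(F s) ≤ n) {A : Finset S} (hA : A.Nonempty) :
    ∃ a ∈ A, #{s ∈ A | a ∈ F s} ≤ n := by
  refine Finset.exists_le_of_sum_le hA ?_
  calc ∑ a ∈ A, #{s ∈ A | a ∈ F s} = ∑ s ∈ A, #{a ∈ A | a ∈ F s} :=
        (sum_card_bipartiteAbove_eq_sum_card_bipartiteBelow (fun s a ↦ a ∈ F s)).symm
    _ ≤ ∑ _s ∈ A, n := by
        refine sum_le_sum fun s _ ↦ (card_le_card fun a ha ↦ ?_).trans (hcard s)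
        exact (mem_filter.mp ha).2

/-- A set mapping with values of size at most `n` admits a proper `(2 * n + 1)`-coloring
on every finite set. -/
lemma exists_coloring_on_finset {S : Type*} {n : ℕ} (F : S → Finset S)
    (hcard : ∀ s, (F s).card ≤ n) (hirr : ∀ s, s ∉ F s) (A : Finset S) :
    ∃ c : S → Fin (2 * n + 1), ∀ s ∈ A, ∀ t ∈ A, t ∈ F s → c s ≠ c t := by
  classical
  induction A using Finset.strongInduction with
  | H A ih =>
    obtain rfl | hA := A.eq_empty_or_nonempty
    · exact ⟨fun _ ↦ 0, by simp⟩
    obtain ⟨a, haA, ha⟩ := exists_card_filter_mem_le F hcard hA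
    obtain ⟨c, hc⟩ := ih _ (Finset.erase_ssubset haA)
    have hcard_used : ((F a ∪ {s ∈ A | a ∈ F s}).image c).card
        < (Finset.univ : Finset (Fin (2 * n + 1))).card := by
      have h₁ := Finset.card_image_le (s := F a ∪ {s ∈ A | a ∈ F s}) (f := c)
      have h₂ := Finset.card_union_le (F a) {s ∈ A | a ∈ F s}
      have h₃ := hcard a
      rw [Finset.card_univ, Fintype.card_fin]
      lia
    obtain ⟨k, -, hk⟩ := Finset.exists_mem_notMem_of_card_lt_card hcard_used
    have hne : ∀ s, s ∈ F a ∨ (s ∈ A ∧ a ∈ F s) → c s ≠ k := fun s hs h ↦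
      hk (Finset.mem_image.mpr ⟨s, by simpa using hs, h⟩)
    refine ⟨Function.update c a k, fun s hs t ht hts ↦ ?_⟩
    by_cases hsa : s = a
    · subst hsa
      have hta : t ≠ s := fun h ↦ hirr s (h ▸ hts)
      simpa [hta] using (hne t (.inl hts)).symm
    by_cases hta : t = a
    · subst hta
      simpa [hsa] using hne s (.inr ⟨hs, hts⟩)
    · simpa [hsa, hta] using
        hc s (Finset.mem_erase.mpr ⟨hsa, hs⟩) t (Finset.mem_erase.mpr ⟨hta, ht⟩) hts

/-- A set mapping with values of size at most `n` admits a proper `(2 * n + 1)`-coloring. -/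
lemma exists_coloring {S : Type*} {n : ℕ} (F : S → Finset S)
    (hcard : ∀ s, (F s).card ≤ n) (hirr : ∀ s, s ∉ F s) :
    ∃ c : S → Fin (2 * n + 1), ∀ s, ∀ t ∈ F s, c s ≠ c t := by
  classical
  choose g hg using exists_coloring_on_finset F hcard hirr
  obtain ⟨c, hc⟩ := Finset.rado_selection (β := fun _ ↦ Fin (2 * n + 1)) g
  refine ⟨c, fun s t hts ↦ ?_⟩
  obtain ⟨A, hA, hcA⟩ := hc {s, t}
  rw [hcA s (by simp), hcA t (by simp)]
  exact hg A s (hA (by simp)) t (hA (by simp)) hts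

end SetMapping

/-- Fodor's free set theorem (order `ω` case): if `f` assigns to each `s ∈ S` a finite set
`f s ⊆ S` with `s ∉ f s`, then `S` is the union of countably many `f`-free sets, where
`T` is `f`-free when `f t ∩ T = ∅` for every `t ∈ T`. -/
theorem fodor_free_set_omega {S : Type u} (f : S → Set S)
    (hfin : ∀ s, (f s).Finite) (hirr : ∀ s, s ∉ f s) :
    ∃ H : ℕ → Set S, (⋃ n, H n) = Set.univ ∧ ∀ n, ∀ t ∈ H n, f t ∩ H n = ∅ := by
  let F (s : S) : Finset S := (hfin s).toFinset
  have hcolor (n : ℕ) : ∃ c : S → Fin (2 * n + 1),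
      ∀ s, (F s).card ≤ n → ∀ t ∈ F s, c s ≠ c t := by
    obtain ⟨c, hc⟩ := SetMapping.exists_coloring (n := n)
      (fun s ↦ if (F s).card ≤ n then F s else ∅)
      (fun s ↦ by split_ifs with h <;> simp [h])
      (fun s ↦ by split_ifs <;> simp [F, hirr])
    exact ⟨c, fun s hs t ht ↦ hc s t (by simpa [hs] using ht)⟩
  choose c hc using hcolor
  let color (s : S) : ℕ := Nat.pair (F s).card (c (F s).card s)
  refine ⟨fun n ↦ {s | color s = n}, by ext; simp, fun n t ht ↦ ?_⟩
  refine Set.eq_empty_iff_forall_notMem.mpr fun u ⟨hut, hu⟩ ↦ ?_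
  obtain ⟨hcard, hval⟩ := Nat.pair_eq_pair.mp (ht.trans hu.symm)
  rw [← hcard] at hval
  exact hc _ t le_rfl u ((hfin t).mem_toFinset.mpr hut) (Fin.ext hval)
end

section
/- Let X be a normal T1 topological space, let τ be an infinite cardinal, and suppose K ⊆ X is a closed subset that is discrete in the subspace topology with |K| > 2^τ. Then there is an open cover 𝒰 of X that admits no subcover representable as the union of at most τ many linked subfamilies. Consequently, for every normal T1 space X, e(X) ≤ 2^{ll(X)}, where e(X) is the extent and ll(X) the linked-Lindelöf number. -/
open Set Cardinal

universe u

/-- A family of sets is linked if every two of its members meet. -/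
def IsLinkedFam {X : Type u} (L : Set (Set X)) : Prop :=
  ∀ U ∈ L, ∀ V ∈ L, (U ∩ V).Nonempty

/-- `𝒱` is representable as the union of at most `τ` many linked subfamilies. -/
def LinkedDecomp {X : Type u} (τ : Cardinal.{u}) (𝒱 : Set (Set X)) : Prop :=
  ∃ P : Set (Set (Set X)), #P ≤ τ ∧ ⋃₀ P = 𝒱 ∧ ∀ L ∈ P, IsLinkedFam L

/-- The linked-Lindelöf number `ll(X)`: the least cardinal `τ` such that every open cover of `X`
has a subcover representable as the union of at most `τ` many linked subfamilies. -/
noncomputable def linkedLindelofNumber (X : Type u) [TopologicalSpace X] : Cardinal.{u} :=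
  sInf {τ | ∀ 𝒰 : Set (Set X), (∀ U ∈ 𝒰, IsOpen U) → ⋃₀ 𝒰 = Set.univ →
    ∃ 𝒱 ⊆ 𝒰, ⋃₀ 𝒱 = Set.univ ∧ LinkedDecomp τ 𝒱}

/-- The extent `e(X)`: the supremum of cardinalities of closed discrete subsets of `X`. -/
noncomputable def extent (X : Type u) [TopologicalSpace X] : Cardinal.{u} :=
  sSup {c | ∃ F : Set X, IsClosed F ∧ DiscreteTopology F ∧ c = #F}

/-- Every assignment of open neighbourhoods to the points of a closed discrete set `K` yields an
open cover for which a decomposition of a subcover into at most `τ` linked families colours `K`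
by at most `τ` colours so that points of equal colour have intersecting neighbourhoods. -/
theorem exists_openCover_coloring {X : Type u} [TopologicalSpace X] {K : Set X}
    (hK : IsClosed K) [DiscreteTopology K] (U : K → Set X) (hUo : ∀ x, IsOpen (U x))
    (hU : ∀ x : K, (x : X) ∈ U x) :
    ∃ 𝒰 : Set (Set X), (∀ V ∈ 𝒰, IsOpen V) ∧ ⋃₀ 𝒰 = Set.univ ∧
      ∀ τ : Cardinal.{u}, ∀ 𝒱 ⊆ 𝒰, ⋃₀ 𝒱 = Set.univ → LinkedDecomp τ 𝒱 →
        ∃ (T : Type u) (c : K → T), #T ≤ τ ∧ ∀ x y, c x = c y → (U x ∩ U y).Nonempty := by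
  have hcl (A : Set K) : IsClosed ((↑) '' A : Set X) :=
    hK.isClosedEmbedding_subtypeVal.isClosedMap A (isClosed_discrete A)
  let W (x : K) : Set X := U x \ ((↑) '' ({x}ᶜ : Set K))
  have hxW (x : K) : (x : X) ∈ W x := by
    refine ⟨hU x, ?_⟩
    rintro ⟨y, hy, hyx⟩
    exact hy (Subtype.ext hyx)
  refine ⟨insert Kᶜ (range W), ?_, ?_, ?_⟩
  · rintro V (rfl | ⟨x, rfl⟩)
    · exact hK.isOpen_compl
    · exact (hUo x).sdiff (hcl _)
  · refine eq_univ_of_forall fun x => ?_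
    by_cases hx : x ∈ K
    · exact ⟨W ⟨x, hx⟩, Or.inr ⟨_, rfl⟩, hxW ⟨x, hx⟩⟩
    · exact ⟨Kᶜ, Or.inl rfl, hx⟩
  · rintro τ 𝒱 h𝒱 hcov ⟨P, hP, rfl, hL⟩
    have hmem (x : K) : ∃ L : P, W x ∈ (L : Set (Set X)) := by
      obtain ⟨V, ⟨L, hLP, hVL⟩, hxV⟩ : (x : X) ∈ ⋃₀ ⋃₀ P := hcov ▸ mem_univ _
      rcases h𝒱 ⟨L, hLP, hVL⟩ with rfl | ⟨y, rfl⟩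
      · exact absurd x.2 hxV
      · have hxy : x = y := by
          by_contra hne
          exact hxV.2 ⟨x, hne, rfl⟩
        exact ⟨⟨L, hLP⟩, hxy ▸ hVL⟩
    choose c hc using hmem
    exact ⟨P, c, hP, fun x y hxy => (hL _ (c x).2 _ (hc x) _ (hxy ▸ hc y)).mono
      (inter_subset_inter sdiff_subset sdiff_subset)⟩

/-- The shift graph on a set of more than `2 ^ #T` points has no proper colouring by `T`. -/
theorem exists_shift_monochromatic {I T : Type u} (h : 2 ^ #T < #I) (d : I × I → T) :
    ∃ a b c : I, a ≠ b ∧ b ≠ c ∧ d (a, b) = d (b, c) := by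
  let S (a : I) : Set T := {t | ∃ b, a ≠ b ∧ d (a, b) = t}
  obtain ⟨a, b, hS, hab⟩ : ∃ a b, S a = S b ∧ a ≠ b := by
    by_contra! hinj
    exact h.not_ge (mk_set (α := T) ▸ mk_le_of_injective (f := S) hinj)
  obtain ⟨c, hbc, hc⟩ : d (a, b) ∈ S b := hS ▸ ⟨b, hab, rfl⟩
  exact ⟨a, b, c, hab, hbc, hc.symm⟩

/-- A closed discrete subset of a normal space of infinite cardinality greater than `2 ^ τ` has
open neighbourhoods of its points such that every colouring by at most `τ` colours gives two
points with disjoint neighbourhoods the same colour. -/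
theorem exists_nhds_not_colorable {X : Type u} [TopologicalSpace X] [NormalSpace X] {K : Set X}
    (hK : IsClosed K) [DiscreteTopology K] {τ : Cardinal.{u}} (hτ : 2 ^ τ < #K) (hinf : ℵ₀ ≤ #K) :
    ∃ U : K → Set X, (∀ x, IsOpen (U x)) ∧ (∀ x : K, (x : X) ∈ U x) ∧
      ∀ (T : Type u) (c : K → T), #T ≤ τ → ∃ x y, c x = c y ∧ Disjoint (U x) (U y) := by
  have hcl (A : Set K) : IsClosed ((↑) '' A : Set X) :=
    hK.isClosedEmbedding_subtypeVal.isClosedMap A (isClosed_discrete A)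
  obtain ⟨e⟩ : Nonempty (K ≃ K × K) := by
    rw [← Cardinal.eq, ← mul_def, mul_eq_self hinf]
  let A (i : K) : Set K := {x | (e x).1 = i ∧ (e x).2 ≠ i}
  let B (i : K) : Set K := {x | (e x).2 = i ∧ (e x).1 ≠ i}
  have hsep (i : K) : SeparatedNhds ((↑) '' A i : Set X) ((↑) '' B i) :=
    normal_separation (hcl _) (hcl _) <|
      (disjoint_image_iff Subtype.val_injective).2 <|
        disjoint_left.2 fun x hA hB => hB.2 hA.1
  choose V W hV hW hAV hBW hVW using hsep
  classical
  refine ⟨fun x => if (e x).1 = (e x).2 then univ else V (e x).1 ∩ W (e x).2, ?_, ?_, ?_⟩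
  · intro x
    dsimp only
    split_ifs
    · exact isOpen_univ
    · exact (hV _).inter (hW _)
  · intro x
    dsimp only
    split_ifs with h
    · exact mem_univ _
    · exact ⟨hAV _ ⟨x, ⟨rfl, Ne.symm h⟩, rfl⟩, hBW _ ⟨x, ⟨rfl, h⟩, rfl⟩⟩
  · intro T c hT
    obtain ⟨i, j, k, hij, hjk, hd⟩ := exists_shift_monochromatic
      ((power_le_power_left two_ne_zero hT).trans_lt hτ) (c ∘ e.symm)
    refine ⟨e.symm (i, j), e.symm (j, k), hd, ?_⟩
    simp only [Equiv.apply_symm_apply, if_neg hij, if_neg hjk]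
    exact (hVW j).symm.mono inter_subset_right inter_subset_left

/-- The linked-Lindelöf number is attained. -/
theorem linkedLindelofNumber_spec {X : Type u} [TopologicalSpace X] (𝒰 : Set (Set X))
    (ho : ∀ U ∈ 𝒰, IsOpen U) (hcov : ⋃₀ 𝒰 = Set.univ) :
    ∃ 𝒱 ⊆ 𝒰, ⋃₀ 𝒱 = Set.univ ∧ LinkedDecomp (linkedLindelofNumber X) 𝒱 := by
  suffices hne : {τ : Cardinal.{u} | ∀ 𝒰 : Set (Set X), (∀ U ∈ 𝒰, IsOpen U) → ⋃₀ 𝒰 = Set.univ →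
      ∃ 𝒱 ⊆ 𝒰, ⋃₀ 𝒱 = Set.univ ∧ LinkedDecomp τ 𝒱}.Nonempty from
    csInf_mem hne 𝒰 ho hcov
  refine ⟨#(Set (Set X)), fun 𝒰 _ hcov => ⟨𝒰 \ {∅}, sdiff_subset, ?_, ?_⟩⟩
  · rw [sUnion_sdiff_singleton_empty, hcov]
  · refine ⟨singleton '' (𝒰 \ {∅}), mk_set_le _, ?_, ?_⟩
    · rw [sUnion_image, biUnion_of_singleton]
    · rintro _ ⟨U, hU, rfl⟩ _ rfl _ rfl
      simpa [nonempty_iff_ne_empty] using hU.2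

/-- The cardinality of a finite subset of a Hausdorff space is at most the linked-Lindelöf
number. -/
theorem card_le_linkedLindelofNumber {X : Type u} [TopologicalSpace X] [T2Space X]
    (s : Finset X) : (s.card : Cardinal.{u}) ≤ linkedLindelofNumber X := by
  obtain ⟨U, hU, hdisj⟩ := s.finite_toSet.t2_separation
  obtain ⟨𝒰, ho, hcov, h⟩ := exists_openCover_coloring (K := (s : Set X))
    s.finite_toSet.isClosed (fun x => U x) (fun x => (hU x).2) (fun x => (hU x).1)
  obtain ⟨𝒱, h𝒱, hcov', hdec⟩ := linkedLindelofNumber_spec 𝒰 ho hcov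
  obtain ⟨T, c, hT, hc⟩ := h _ 𝒱 h𝒱 hcov' hdec
  have hinj : Function.Injective c := fun x y hxy => Subtype.ext <| by
    by_contra hne
    exact (hc x y hxy).ne_empty (disjoint_iff_inter_eq_empty.1 (hdisj x.2 y.2 hne))
  simpa using (mk_le_of_injective hinj).trans hT

/-- If `X` is a normal T1 space, `τ` an infinite cardinal and `K ⊆ X` a closed discrete subset
with `|K| > 2 ^ τ`, then some open cover of `X` admits no subcover representable as the union of
at most `τ` many linked subfamilies.  Consequently, `e(X) ≤ 2 ^ ll(X)` for every normal T1
space `X`. -/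
theorem extent_le_two_pow_linkedLindelof :
    (∀ (X : Type u) [TopologicalSpace X] [NormalSpace X] [T1Space X]
      (τ : Cardinal.{u}), ℵ₀ ≤ τ →
      ∀ K : Set X, IsClosed K → DiscreteTopology K → 2 ^ τ < #K →
      ∃ 𝒰 : Set (Set X), (∀ U ∈ 𝒰, IsOpen U) ∧ ⋃₀ 𝒰 = Set.univ ∧
        ∀ 𝒱 ⊆ 𝒰, ⋃₀ 𝒱 = Set.univ → ¬ LinkedDecomp τ 𝒱) ∧
    (∀ (X : Type u) [TopologicalSpace X] [NormalSpace X] [T1Space X],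
      extent X ≤ 2 ^ linkedLindelofNumber X) := by
  have large (X : Type u) [TopologicalSpace X] [NormalSpace X] [T1Space X]
      (τ : Cardinal.{u}) (hτ : ℵ₀ ≤ τ) (K : Set X) (hK : IsClosed K) (_ : DiscreteTopology K)
      (hcard : 2 ^ τ < #K) :
      ∃ 𝒰 : Set (Set X), (∀ U ∈ 𝒰, IsOpen U) ∧ ⋃₀ 𝒰 = Set.univ ∧
        ∀ 𝒱 ⊆ 𝒰, ⋃₀ 𝒱 = Set.univ → ¬ LinkedDecomp τ 𝒱 := by
    obtain ⟨U, hUo, hU, hcol⟩ := exists_nhds_not_colorable hK hcard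
      (hτ.trans ((cantor τ).trans hcard).le)
    obtain ⟨𝒰, ho, hcov, h⟩ := exists_openCover_coloring hK U hUo hU
    refine ⟨𝒰, ho, hcov, fun 𝒱 h𝒱 hcov' hdec => ?_⟩
    obtain ⟨T, c, hT, hc⟩ := h τ 𝒱 h𝒱 hcov' hdec
    obtain ⟨x, y, hxy, hdisj⟩ := hcol T c hT
    exact (hc x y hxy).ne_empty (disjoint_iff_inter_eq_empty.1 hdisj)
  refine ⟨large, fun X _ _ _ => csSup_le' ?_⟩
  rintro _ ⟨F, hF, hFd, rfl⟩
  by_contra! hlt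
  rcases le_or_gt ℵ₀ (linkedLindelofNumber X) with hinf | hfin
  · obtain ⟨𝒰, ho, hcov, h⟩ := large X _ hinf F hF hFd hlt
    obtain ⟨𝒱, h𝒱, hcov', hdec⟩ := linkedLindelofNumber_spec 𝒰 ho hcov
    exact h 𝒱 h𝒱 hcov' hdec
  · refine ((cantor _).trans hlt).not_ge ?_
    obtain ⟨n, hn⟩ := lt_aleph0.1 hfin
    rw [hn, mk_le_iff_forall_finset_subset_card_le]
    exact fun s _ => by exact_mod_cast hn ▸ card_le_linkedLindelofNumber s
end

section
/- Let X be a normal T1 space of countable weak extent, i.e., for every open cover 𝒰 of X there is a countable A ⊆ X with St(A,𝒰) = X. Then every closed subset of X that is discrete in the subspace topology has cardinality at most 𝔠 = 2^{ℵ₀}. -/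
open Set Cardinal

universe u

/-- In a normal T1 space of countable weak extent (star-Lindelöf: every open cover `𝒰` admits a
countable `A` with `St(A,𝒰) = X`), every closed discrete subset has cardinality at most
`𝔠 = 2 ^ ℵ₀`. -/
theorem closed_discrete_le_continuum_of_normal_countable_weak_extent
    {X : Type u} [TopologicalSpace X] [NormalSpace X] [T1Space X]
    (hwe : ∀ 𝒰 : Set (Set X), (∀ U ∈ 𝒰, IsOpen U) → ⋃₀ 𝒰 = Set.univ →
      ∃ A : Set X, A.Countable ∧ ⋃₀ {U ∈ 𝒰 | (U ∩ A).Nonempty} = Set.univ)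
    (F : Set X) (hF : IsClosed F) (hFd : DiscreteTopology F) :
    #F ≤ 2 ^ ℵ₀ := by
  rcases lt_or_ge #F ℵ₀ with hfin | hinf
  · exact hfin.le.trans (cantor _).le
  obtain ⟨e⟩ : Nonempty (F ≃ F × F) := by
    rw [← Cardinal.eq, mk_prod, lift_id, mul_eq_self hinf]
  have hcl : ∀ S : Set F, IsClosed ((↑) '' S : Set X) := fun S =>
    hF.isClosedEmbedding_subtypeVal.isClosedMap S (isClosed_discrete S)
  -- Separate each fibre `{x | (e x).1 = i}` from its complement in `F`.
  have hsep : ∀ i : F, ∃ U V : Set X, IsOpen U ∧ IsOpen V ∧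
      (∀ x : F, (e x).1 = i → (x : X) ∈ U) ∧ (∀ x : F, (e x).1 ≠ i → (x : X) ∈ V) ∧
      Disjoint U V := by
    intro i
    obtain ⟨U, V, hU, hV, hSU, hTV, hUV⟩ := normal_separation
      (hcl {x | (e x).1 = i}) (hcl {x | (e x).1 = i}ᶜ)
      ((disjoint_image_iff Subtype.val_injective).2 disjoint_compl_right)
    exact ⟨U, V, hU, hV, fun x hx => hSU ⟨x, hx, rfl⟩, fun x hx => hTV ⟨x, hx, rfl⟩, hUV⟩
  choose U V hU hV hSU hTV hUV using hsep
  let G : F → Set X := fun x => {y | (e x).1 ≠ (e x).2 → y ∈ U (e x).1 ∩ V (e x).2}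
  let W : F → Set X := fun x => ((↑) '' ({x}ᶜ : Set F))ᶜ ∩ G x
  have hW : ∀ x, IsOpen (W x) := by
    intro x
    refine (hcl _).isOpen_compl.inter ?_
    by_cases h : (e x).1 = (e x).2
    · simp [G, h]
    · simpa [G, h] using (hU _).inter (hV _)
  have hxW : ∀ x : F, (x : X) ∈ W x := fun x =>
    ⟨by simp, fun h => ⟨hSU _ x rfl, hTV _ x h⟩⟩
  have hWF : ∀ x y : F, (x : X) ∈ W y → y = x := by
    rintro x y ⟨h, -⟩
    by_contra hne
    exact h ⟨x, fun hxy => hne hxy.symm, rfl⟩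
  obtain ⟨A, hA, hAcov⟩ := hwe (insert Fᶜ (range W))
    (by rintro _ (rfl | ⟨x, rfl⟩); exacts [hF.isOpen_compl, hW x])
    (by
      refine eq_univ_of_forall fun x => ?_
      by_cases hx : x ∈ F
      · exact ⟨W ⟨x, hx⟩, Or.inr ⟨_, rfl⟩, hxW ⟨x, hx⟩⟩
      · exact ⟨Fᶜ, Or.inl rfl, hx⟩)
  have hmeet : ∀ x, (W x ∩ A).Nonempty := by
    intro x
    obtain ⟨_, ⟨rfl | ⟨y, rfl⟩, hne⟩, hx⟩ := hAcov.ge (mem_univ (x : X))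
    · exact absurd x.2 hx
    · exact hWF x y hx ▸ hne
  have hinj : Function.Injective fun i : F => {a : A | (a : X) ∈ U i} := by
    intro i j hij
    by_contra hne
    obtain ⟨a, ⟨-, haG⟩, haA⟩ := hmeet (e.symm (i, j))
    simp only [G, mem_ofPred_eq, Equiv.apply_symm_apply] at haG
    obtain ⟨hai, haj⟩ := haG hne
    have haU : a ∈ U j := (Set.ext_iff.1 hij ⟨a, haA⟩).1 hai
    exact (hUV j).notMem_of_mem_left haU haj
  calc #F ≤ #(Set A) := mk_le_of_injective hinj
    _ = 2 ^ #A := mk_set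
    _ ≤ 2 ^ ℵ₀ := power_le_power_left two_ne_zero hA.le_aleph0
end

section
/- Let X be a T1 topological space and κ an infinite cardinal. If there is an open cover 𝒰 of X such that for every subset A ⊆ X with |A| ≤ κ one has St(A,𝒰) ≠ X, then X contains a closed discrete subset of cardinality κ. In particular, we(X) ≤ e(X) for every T1 space X. -/
open Set Cardinal

universe u

/-- The weak extent `we(X)`: the least cardinal `τ` such that for every open cover `𝒰` of `X`
there is `A ⊆ X` with `|A| ≤ τ` and `St(A,𝒰) = X`. -/
noncomputable def weakExtent (X : Type u) [TopologicalSpace X] : Cardinal.{u} :=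
  sInf {τ | ∀ 𝒰 : Set (Set X), (∀ U ∈ 𝒰, IsOpen U) → ⋃₀ 𝒰 = Set.univ →
    ∃ A : Set X, #A ≤ τ ∧ ⋃₀ {U ∈ 𝒰 | (U ∩ A).Nonempty} = Set.univ}

/-- In a T1 space, a set meeting each member of an open cover in at most one point is closed. -/
theorem isClosed_of_subsingleton_inter {X : Type u} [TopologicalSpace X] [T1Space X]
    {𝒰 : Set (Set X)} (ho : ∀ U ∈ 𝒰, IsOpen U) (hc : ⋃₀ 𝒰 = Set.univ) {F : Set X}
    (hF : ∀ U ∈ 𝒰, (U ∩ F).Subsingleton) : IsClosed F := by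
  rw [← isOpen_compl_iff, isOpen_iff_forall_mem_open]
  intro x hx
  obtain ⟨U, hU, hxU⟩ : x ∈ ⋃₀ 𝒰 := hc ▸ mem_univ x
  exact ⟨U \ (U ∩ F), fun y hy hyF => hy.2 ⟨hy.1, hyF⟩,
    (ho U hU).sdiff (hF U hU).finite.isClosed, hxU, fun h => hx h.2⟩

/-- A set meeting each member of an open cover in at most one point is discrete. -/
theorem discreteTopology_of_subsingleton_inter {X : Type u} [TopologicalSpace X]
    {𝒰 : Set (Set X)} (ho : ∀ U ∈ 𝒰, IsOpen U) (hc : ⋃₀ 𝒰 = Set.univ) {F : Set X}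
    (hF : ∀ U ∈ 𝒰, (U ∩ F).Subsingleton) : DiscreteTopology F := by
  rw [discreteTopology_iff_isOpen_singleton]
  intro x
  obtain ⟨U, hU, hxU⟩ : (x : X) ∈ ⋃₀ 𝒰 := hc ▸ mem_univ _
  refine ⟨U, ho U hU, ?_⟩
  ext y
  exact ⟨fun hy => Subtype.ext (hF U hU ⟨hy, y.2⟩ ⟨hxU, x.2⟩), fun hy => hy ▸ hxU⟩

/-- Every cover admits a set meeting each of its members in at most one point whose star is the
whole space. -/
theorem exists_subsingleton_inter_star_eq_univ {X : Type u} {𝒰 : Set (Set X)}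
    (hc : ⋃₀ 𝒰 = Set.univ) :
    ∃ F : Set X, (∀ U ∈ 𝒰, (U ∩ F).Subsingleton) ∧
      ⋃₀ {U ∈ 𝒰 | (U ∩ F).Nonempty} = Set.univ := by
  obtain ⟨F, hF⟩ := zorn_subset {F : Set X | ∀ U ∈ 𝒰, (U ∩ F).Subsingleton} (by
    intro c hcS hchain
    refine ⟨⋃₀ c, ?_, fun s hs => subset_sUnion_of_mem hs⟩
    rintro U hU x ⟨hxU, s, hs, hxs⟩ y ⟨hyU, t, ht, hyt⟩
    rcases hchain.total hs ht with h | h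
    · exact hcS ht U hU ⟨hxU, h hxs⟩ ⟨hyU, hyt⟩
    · exact hcS hs U hU ⟨hxU, hxs⟩ ⟨hyU, h hyt⟩)
  refine ⟨F, hF.prop, eq_univ_of_forall fun x => ?_⟩
  by_contra hx
  have hdisj : ∀ U ∈ 𝒰, x ∈ U → ∀ y ∈ U, y ∉ F := fun U hU hxU y hyU hyF =>
    hx ⟨U, ⟨hU, y, hyU, hyF⟩, hxU⟩
  have hins : ∀ U ∈ 𝒰, (U ∩ insert x F).Subsingleton := by
    rintro U hU y ⟨hyU, rfl | hyF⟩ z ⟨hzU, rfl | hzF⟩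
    · rfl
    · exact absurd hzF (hdisj U hU hyU z hzU)
    · exact absurd hyF (hdisj U hU hzU y hyU)
    · exact hF.prop U hU ⟨hyU, hyF⟩ ⟨hzU, hzF⟩
  have hxF : x ∈ F := hF.le_of_ge hins (subset_insert x F) (mem_insert x F)
  obtain ⟨U, hU, hxU⟩ : x ∈ ⋃₀ 𝒰 := hc ▸ mem_univ x
  exact hdisj U hU hxU x hxU hxF

/-- If `X` is T1, `κ` an infinite cardinal and `𝒰` an open cover such that no set `A` of
cardinality at most `κ` satisfies `St(A,𝒰) = X`, then `X` has a closed discrete subset of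
cardinality `κ`.  In particular, `we(X) ≤ e(X)` for every T1 space `X`. -/
theorem weakExtent_le_extent :
    (∀ (X : Type u) [TopologicalSpace X] [T1Space X] (κ : Cardinal.{u}), ℵ₀ ≤ κ →
      ∀ 𝒰 : Set (Set X), (∀ U ∈ 𝒰, IsOpen U) → ⋃₀ 𝒰 = Set.univ →
      (∀ A : Set X, #A ≤ κ → ⋃₀ {U ∈ 𝒰 | (U ∩ A).Nonempty} ≠ Set.univ) →
      ∃ F : Set X, IsClosed F ∧ DiscreteTopology F ∧ #F = κ) ∧
    (∀ (X : Type u) [TopologicalSpace X] [T1Space X], weakExtent X ≤ extent X) := by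
  refine ⟨fun X _ _ κ _ 𝒰 ho hc hstar => ?_, fun X _ _ => csInf_le' fun 𝒰 ho hc => ?_⟩
  · obtain ⟨F, hF, hFstar⟩ := exists_subsingleton_inter_star_eq_univ hc
    have hκ : κ ≤ #F := le_of_not_ge fun h => hstar F h hFstar
    obtain ⟨G, hGF, hG⟩ := le_mk_iff_exists_subset.mp hκ
    have hG' : ∀ U ∈ 𝒰, (U ∩ G).Subsingleton := fun U hU =>
      (hF U hU).anti (inter_subset_inter_right U hGF)
    exact ⟨G, isClosed_of_subsingleton_inter ho hc hG',
      discreteTopology_of_subsingleton_inter ho hc hG', hG⟩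
  · obtain ⟨F, hF, hFstar⟩ := exists_subsingleton_inter_star_eq_univ hc
    refine ⟨F, le_csSup ⟨#X, ?_⟩ ⟨F, isClosed_of_subsingleton_inter ho hc hF,
      discreteTopology_of_subsingleton_inter ho hc hF, rfl⟩, hFstar⟩
    rintro _ ⟨G, -, -, rfl⟩
    exact mk_set_le G
end

section
/- Let τ be an infinite cardinal and for each α < τ let A_α be a finite subset of τ with α ∉ A_α. Then there exists a countable set C of functions from τ to {0,1} such that for every α < τ there is c ∈ C with c(α) = 1 and c(α') = 0 for all α' ∈ A_α. (Equivalently, the countable set C meets every basic open set B_α = {x ∈ {0,1}^τ : x(α) = 1 and x(α') = 0 for all α' ∈ A_α}.) -/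
open Set Cardinal

universe u

/-- Greedy colouring: along a well-founded relation, one can choose natural numbers so that each
point avoids the colours of its predecessors in a prescribed finite set. -/
theorem WellFounded.exists_nat_coloring {ι : Type u} {r : ι → ι → Prop} (hr : WellFounded r)
    (D : ι → Finset ι) : ∃ f : ι → ℕ, ∀ a, ∀ b ∈ D a, r b a → f b ≠ f a := by
  classical
  let avoid (a : ι) (rec : ∀ b, r b a → ℕ) : Finset ℕ :=
    (D a).image fun b => if h : r b a then rec b h else 0
  let step (a : ι) (rec : ∀ b, r b a → ℕ) : ℕ :=
    (Infinite.exists_notMem_finset (avoid a rec)).choose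
  refine ⟨hr.fix step, fun a b hb hba heq => ?_⟩
  have h := (Infinite.exists_notMem_finset (avoid a fun y _ => hr.fix step y)).choose_spec
  have hfix : hr.fix step a = step a fun y _ => hr.fix step y := hr.fix_eq step a
  change step a (fun y _ => hr.fix step y) ∉ _ at h
  rw [← hfix, ← heq] at h
  exact h (Finset.mem_image.2 ⟨b, hb, by simp [hba]⟩)

/-- The set of points reachable along a relation with countable successor sets is countable. -/
theorem Relation.ReflTransGen.countable_setOf {ι : Type u} {r : ι → ι → Prop}
    (hr : ∀ a, {b | r a b}.Countable) (a : ι) : {b | Relation.ReflTransGen r a b}.Countable := by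
  let S : ℕ → Set ι := fun n => Nat.rec {a} (fun _ T => ⋃ x ∈ T, {b | r x b}) n
  have hS (n : ℕ) : (S n).Countable := by
    induction n with
    | zero => exact countable_singleton a
    | succ n ih => exact ih.biUnion fun x _ => hr x
  refine (countable_iUnion hS).mono fun b hb => ?_
  induction hb with
  | refl => exact mem_iUnion.2 ⟨0, rfl⟩
  | @tail b c _ hbc ih =>
    obtain ⟨n, hn⟩ := mem_iUnion.1 ih
    exact mem_iUnion.2 ⟨n + 1, mem_iUnion₂.2 ⟨b, hn, hbc⟩⟩

/-- Fodor's free set theorem for set mappings with finite values: the underlying set is a union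
of countably many free sets. -/
theorem exists_nat_coloring_of_finite_setMapping {ι : Type u} (A : ι → Finset ι)
    (hA : ∀ a, a ∉ A a) : ∃ f : ι → ℕ, ∀ a, ∀ b ∈ A a, f b ≠ f a := by
  classical
  obtain ⟨_, _⟩ := exists_wellFoundedLT ι
  let cl (a : ι) : Set ι := {b | Relation.ReflTransGen (fun x y => y ∈ A x) a b}
  have hcl (a : ι) : (cl a).Countable :=
    Relation.ReflTransGen.countable_setOf (fun x => (A x).countable_toSet) a
  choose e he using fun a => (countable_iff_exists_injOn.1 (hcl a))
  have hne (a : ι) : {b | a ∈ cl b}.Nonempty := ⟨a, Relation.ReflTransGen.refl⟩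
  let i (a : ι) : ι := wellFounded_lt.min {b | a ∈ cl b} (hne a)
  have hi (a : ι) : a ∈ cl (i a) := wellFounded_lt.min_mem _ (hne a)
  have hile {a b : ι} (hb : b ∈ A a) : i b ≤ i a :=
    not_lt.1 (wellFounded_lt.not_lt_min {c | b ∈ cl c} (Relation.ReflTransGen.tail (hi a) hb))
  have hfin (a : ι) : {b | i b = i a ∧ e (i a) b < e (i a) a}.Finite := by
    refine Set.Finite.of_finite_image (f := e (i a))
      ((finite_Iio (e (i a) a)).subset ?_) ?_
    · rintro _ ⟨b, hb, rfl⟩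
      exact hb.2
    · intro b hb c hc h
      exact he (i a) (hb.1 ▸ hi b) (hc.1 ▸ hi c) h
  have hwf : WellFounded (InvImage (Prod.Lex (· < ·) (· < ·)) fun a => (i a, e (i a) a)) :=
    InvImage.wf _ (wellFounded_lt.prod_lex wellFounded_lt)
  obtain ⟨f, hf⟩ := hwf.exists_nat_coloring fun a => A a ∪ (hfin a).toFinset
  refine ⟨f, fun a b hb => ?_⟩
  have hlex {x y : ι} (hxy : i x = i y) (h : e (i y) x < e (i y) y) :
      InvImage (Prod.Lex (· < ·) (· < ·)) (fun a => (i a, e (i a) a)) x y :=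
    Prod.lex_def.2 (Or.inr ⟨hxy, by simpa only [hxy] using h⟩)
  rcases (hile hb).lt_or_eq with h | h
  · exact hf a b (Finset.mem_union_left _ hb) (Prod.Lex.left _ _ h)
  · rcases lt_trichotomy (e (i a) b) (e (i a) a) with h' | h' | h'
    · exact hf a b (Finset.mem_union_left _ hb) (hlex h h')
    · exact absurd (he (i a) (h ▸ hi b) (hi a) h' ▸ hb) (hA a)
    · rw [← h] at h'
      exact (hf b a (Finset.mem_union_right _ ((hfin b).mem_toFinset.2 ⟨h.symm, h'⟩))
        (hlex h.symm h')).symm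

/-- Let `τ` be an infinite cardinal (realized as a type `ι` of cardinality `τ`) and for every
`α` let `A α` be a finite subset of `ι` with `α ∉ A α`.  Then there is a countable set `C` of
functions `ι → Bool` such that for every `α` some `c ∈ C` has `c α = 1` and `c α' = 0` for all
`α' ∈ A α`; i.e. `C` meets every basic open set `B_α` of the Cantor cube `{0,1}^τ`. -/
theorem countable_set_meeting_basic_opens
    (τ : Cardinal.{u}) (hτ : ℵ₀ ≤ τ) (ι : Type u) (hι : #ι = τ)
    (A : ι → Finset ι) (hA : ∀ α, α ∉ A α) :
    ∃ C : Set (ι → Bool), C.Countable ∧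
      ∀ α, ∃ c ∈ C, c α = true ∧ ∀ α' ∈ A α, c α' = false := by
  obtain ⟨f, hf⟩ := exists_nat_coloring_of_finite_setMapping A hA
  refine ⟨range fun (n : ℕ) (a : ι) => decide (f a = n), countable_range _, fun a =>
    ⟨_, mem_range_self (f a), by simp, fun b hb => by simpa using hf a b hb⟩⟩
end

section
/- For every infinite set K there exists a family 𝒜 of subsets of K with |𝒜| = |K| such that for all n, m ≥ 0 with n + m ≥ 1 and all distinct A₁, …, A_n, A_{n+1}, …, A_{n+m} ∈ 𝒜, the set A₁ ∩ ⋯ ∩ A_n ∩ (K \ A_{n+1}) ∩ ⋯ ∩ (K \ A_{n+m}) has cardinality |K|. -/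
open Set Cardinal

universe u

/-- On every infinite set `K` there is an independent family `𝒜` of subsets of `K` with
`|𝒜| = |K|` such that every nonempty finite Boolean combination
`A₁ ∩ ⋯ ∩ A_n ∩ (K \ A_{n+1}) ∩ ⋯ ∩ (K \ A_{n+m})` of distinct members of `𝒜` has
cardinality `|K|`. -/
theorem exists_independent_family {K : Type u} [Infinite K] :
    ∃ 𝒜 : Set (Set K), #𝒜 = #K ∧
      ∀ s t : Finset (Set K), ↑s ⊆ 𝒜 → ↑t ⊆ 𝒜 → Disjoint s t → (s.Nonempty ∨ t.Nonempty) →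
        #(((⋂ A ∈ s, A) ∩ ⋂ B ∈ t, Bᶜ : Set K)) = #K := by
  obtain ⟨e⟩ : Nonempty (K ≃ Finset K × K) := by
    rw [← Cardinal.eq, mk_prod, lift_id, lift_id, mk_finset_of_infinite,
      mul_eq_self (aleph0_le_mk K)]
  let A : K → Set K := fun a => {k | a ∈ (e k).1}
  have hA : Function.Injective A := by
    intro a b hab
    have hb : e.symm ({b}, b) ∈ A a := by rw [hab]; simp [A]
    simpa [A] using hb
  refine ⟨range A, mk_range_eq A hA, fun s t hs ht hst _ => ?_⟩
  refine (mk_set_le _).antisymm ?_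
  let S : Finset K := s.preimage A hA.injOn
  have hmem (x : K) : e.symm (S, x) ∈ (⋂ A ∈ s, A) ∩ ⋂ B ∈ t, Bᶜ := by
    simp only [mem_inter_iff, mem_iInter]
    constructor
    · intro B hB
      obtain ⟨b, rfl⟩ := hs hB
      simpa [A, S] using hB
    · intro B hB
      obtain ⟨b, rfl⟩ := ht hB
      have hb : A b ∉ s := fun h => Finset.disjoint_left.mp hst h hB
      simpa [A, S] using hb
  refine mk_le_of_injective (f := fun x => ⟨e.symm (S, x), hmem x⟩) fun x y hxy => ?_
  simpa using hxy
end

section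
/- Let τ be an infinite cardinal and κ an ordinal with cf(κ) > τ. Let D^τ = {0,1}^τ with the product topology, let z_α ∈ D^τ be the point whose only nonzero coordinate is the α-th, Z = {z_α : α < τ}, and let X = (D^τ × [0,κ]) \ ((D^τ \ Z) × {κ}) carry the subspace topology of the product of D^τ with the ordinal interval [0,κ] (order topology). Then X₁ = Z × {κ} is a closed subset of X, discrete in the subspace topology, of cardinality τ; hence e(X) ≥ τ. -/
open Set Cardinal
open scoped Classical

universe u

/-- The point of the Cantor cube `ι → Bool` whose only nonzero coordinate is the `α`-th. -/
noncomputable def zpt {ι : Type u} (α : ι) : ι → Bool := fun i => if i = α then true else false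

/-- `Z = {z_α : α < τ}`. -/
def Zset (ι : Type u) : Set (ι → Bool) := Set.range (zpt (ι := ι))

/-- `X = (D^τ × [0,κ]) \ ((D^τ \ Z) × {κ})`, as a subset of `D^τ × [0,κ]`. -/
def Xset (ι : Type u) (κ : Ordinal.{u}) : Set ((ι → Bool) × ↥(Set.Iic κ)) :=
  {p | (p.2 : Ordinal) = κ → p.1 ∈ Zset ι}

/-- `X₁ = Z × {κ}`, as a subset of `X`. -/
def X1set (ι : Type u) (κ : Ordinal.{u}) : Set ↥(Xset ι κ) :=
  {x | (x : (ι → Bool) × ↥(Set.Iic κ)).1 ∈ Zset ι ∧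
    ((x : (ι → Bool) × ↥(Set.Iic κ)).2 : Ordinal) = κ}

theorem zpt_self {ι : Type u} (α : ι) : zpt α α = true := by simp [zpt]

theorem zpt_apply_eq_true {ι : Type u} {α i : ι} : zpt α i = true ↔ i = α := by simp [zpt]

theorem zpt_injective {ι : Type u} : Function.Injective (zpt (ι := ι)) := fun α _ h =>
  zpt_apply_eq_true.1 (h ▸ zpt_self α)

/-- The points of `X₁` are indexed by the coordinates of the cube. -/
noncomputable def X1setPoint {ι : Type u} (κ : Ordinal.{u}) (α : ι) : X1set ι κ :=
  ⟨⟨(zpt α, ⟨κ, mem_Iic.2 le_rfl⟩), fun _ => ⟨α, rfl⟩⟩, ⟨α, rfl⟩, rfl⟩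

theorem X1setPoint_bijective (ι : Type u) (κ : Ordinal.{u}) :
    Function.Bijective (X1setPoint (ι := ι) κ) := by
  refine ⟨fun _ _ h => zpt_injective (congrArg (fun x : X1set ι κ => x.1.1.1) h), ?_⟩
  rintro ⟨⟨⟨z, o⟩, hx⟩, ⟨α, hα⟩, ho⟩
  exact ⟨α, Subtype.ext (Subtype.ext (Prod.ext hα (Subtype.ext ho.symm)))⟩

theorem isClosed_X1set (ι : Type u) (κ : Ordinal.{u}) : IsClosed (X1set ι κ) := by
  have h : X1set ι κ = (fun x : Xset ι κ => (x.1.2 : Ordinal)) ⁻¹' {κ} := by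
    ext x
    exact ⟨fun hx => hx.2, fun hx => ⟨x.2 hx, hx⟩⟩
  rw [h]
  exact isClosed_singleton.preimage (by fun_prop)

theorem discreteTopology_X1set (ι : Type u) (κ : Ordinal.{u}) :
    DiscreteTopology (X1set ι κ) := by
  refine discreteTopology_iff_isOpen_singleton.2 fun x => ?_
  obtain ⟨α, rfl⟩ := (X1setPoint_bijective ι κ).2 x
  have h : {X1setPoint κ α} = (fun x : X1set ι κ => x.1.1.1 α) ⁻¹' {true} := by
    ext x
    obtain ⟨β, rfl⟩ := (X1setPoint_bijective ι κ).2 x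
    exact ((X1setPoint_bijective ι κ).1.eq_iff.trans eq_comm).trans
      (zpt_apply_eq_true (α := β) (i := α)).symm
  rw [h]
  exact (isOpen_discrete _).preimage (by fun_prop)

theorem mk_X1set (ι : Type u) (κ : Ordinal.{u}) :
    #(X1set ι κ) = Cardinal.lift.{u + 1} #ι := by
  have h := Cardinal.mk_congr_lift (Equiv.ofBijective _ (X1setPoint_bijective ι κ))
  rwa [Cardinal.lift_id'.{u, u + 1}, eq_comm] at h

/-- With `τ` infinite, `cf(κ) > τ`, and `X` the space above (a subspace of the product of the
Cantor cube `D^τ` with the ordinal interval `[0,κ]`), the set `X₁ = Z × {κ}` is closed in `X`,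
discrete in the subspace topology, and of cardinality `τ`; hence `e(X) ≥ τ`. -/
theorem X1_closed_discrete_of_card_tau
    (τ : Cardinal.{u}) (hτ : ℵ₀ ≤ τ) (κ : Ordinal.{u}) (hκ : τ < κ.cof)
    (ι : Type u) (hι : #ι = τ) :
    IsClosed (X1set ι κ) ∧ DiscreteTopology (X1set ι κ) ∧ #(X1set ι κ) = Cardinal.lift.{u + 1} τ := by
  exact ⟨isClosed_X1set ι κ, discreteTopology_X1set ι κ, hι ▸ mk_X1set ι κ⟩
end

section
/- Let τ be an infinite cardinal and κ an ordinal with cf(κ) > τ. Let D^τ = {0,1}^τ with the product topology, z_α ∈ D^τ the point whose only nonzero coordinate is the α-th, Z = {z_α : α < τ}, and X = (D^τ × [0,κ]) \ ((D^τ \ Z) × {κ}) with the subspace topology of D^τ × [0,κ]. Then X is star-Lindelöf: for every open cover 𝒰 of X there exists a countable set A ⊆ X with St(A,𝒰) = X. -/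
open Set Cardinal
open scoped Classical

universe u

/-- A finite set carrying a set mapping with values of size at most `n` splits into `2 * n + 1`
free sets. -/
theorem exists_free_coloring_finset {ι : Type*} (F : ι → Finset ι) (n : ℕ)
    (hF : ∀ a, (F a).card ≤ n) (s : Finset ι) :
    ∃ c : ι → Fin (2 * n + 1), ∀ a ∈ s, ∀ b ∈ s, b ∈ F a → b ≠ a → c b ≠ c a := by
  induction s using Finset.strongInduction with
  | H s ih =>
    rcases s.eq_empty_or_nonempty with rfl | hs
    · exact ⟨fun _ => 0, by simp⟩
    obtain ⟨a, ha, han⟩ : ∃ a ∈ s, (s.filter fun b => a ∈ F b).card ≤ n := by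
      refine Finset.exists_le_of_sum_le hs ?_
      calc ∑ a ∈ s, (s.filter fun b => a ∈ F b).card
          = ∑ b ∈ s, (s.filter fun a => a ∈ F b).card :=
            Finset.sum_card_bipartiteAbove_eq_sum_card_bipartiteBelow fun a b => a ∈ F b
        _ ≤ ∑ _b ∈ s, n := Finset.sum_le_sum fun b _ => (Finset.card_le_card fun x hx =>
            (Finset.mem_filter.1 hx).2).trans (hF b)
    obtain ⟨c, hc⟩ := ih (s.erase a) (Finset.erase_ssubset ha)
    obtain ⟨k, hk⟩ : ∃ k, k ∉ (F a ∪ s.filter fun b => a ∈ F b).image c := by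
      by_contra! h
      have h₁ := Finset.card_le_card fun k (_ : k ∈ Finset.univ) => h k
      have h₂ := h₁.trans (Finset.card_image_le.trans (Finset.card_union_le _ _))
      have h₃ := hF a
      simp only [Finset.card_univ, Fintype.card_fin] at h₂
      omega
    simp only [Finset.mem_image, Finset.mem_union, Finset.mem_filter, not_exists, not_and] at hk
    refine ⟨Function.update c a k, fun x hx y hy hyx hne => ?_⟩
    by_cases hxa : x = a
    · subst hxa
      rw [Function.update_of_ne hne, Function.update_self]
      exact hk y (Or.inl hyx)
    · by_cases hya : y = a
      · subst hya
        rw [Function.update_of_ne hxa, Function.update_self]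
        exact fun h => hk x (Or.inr ⟨hx, hyx⟩) h.symm
      · rw [Function.update_of_ne hxa, Function.update_of_ne hya]
        exact hc x (Finset.mem_erase.2 ⟨hxa, hx⟩) y (Finset.mem_erase.2 ⟨hya, hy⟩) hyx hne

/-- A set mapping with values of size at most `n` splits its domain into `2 * n + 1` free sets. -/
theorem exists_free_coloring_of_card_le {ι : Type*} (F : ι → Finset ι) (n : ℕ)
    (hF : ∀ a, (F a).card ≤ n) :
    ∃ c : ι → Fin (2 * n + 1), ∀ a, ∀ b ∈ F a, b ≠ a → c b ≠ c a := by
  choose g hg using exists_free_coloring_finset F n hF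
  obtain ⟨c, hc⟩ := Finset.rado_selection g
  refine ⟨c, fun a b hb hne => ?_⟩
  obtain ⟨t, hst, ht⟩ := hc {a, b}
  rw [ht a (by simp), ht b (by simp)]
  exact hg t a (hst (by simp)) b (hst (by simp)) hb hne

/-- A set mapping with finite values splits its domain into countably many free sets. -/
theorem exists_countable_free_coloring {ι : Type*} (F : ι → Finset ι) :
    ∃ c : ι → ℕ × ℕ, ∀ a, ∀ b ∈ F a, b ≠ a → c b ≠ c a := by
  have h (n : ℕ) := exists_free_coloring_of_card_le
    (fun a => if (F a).card ≤ n then F a else ∅) n (fun a => by split_ifs <;> simp_all)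
  choose c hc using h
  refine ⟨fun a => ((F a).card, c (F a).card a), fun a b hb hne heq => ?_⟩
  obtain ⟨h₁, h₂⟩ := Prod.mk.inj heq
  rw [h₁] at h₂
  exact hc (F a).card a b (by simpa using hb) hne (Fin.ext h₂)

/-- Countably many points of the Cantor cube meet all members of a family of neighbourhoods of the
points `zpt a`. -/
theorem exists_countable_meeting_nhds_zpt {ι : Type u} (W : ι → Set (ι → Bool))
    (hW : ∀ a, W a ∈ nhds (zpt a)) :
    ∃ C : Set (ι → Bool), C.Countable ∧ ∀ a, (W a ∩ C).Nonempty := by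
  have h (a : ι) : ∃ I : Finset ι, ∀ x : ι → Bool, (∀ i ∈ I, x i = zpt a i) → x ∈ W a := by
    obtain ⟨V, hVW, hV, haV⟩ := mem_nhds_iff.1 (hW a)
    obtain ⟨I, u, hu, hIV⟩ := isOpen_pi_iff.1 hV _ haV
    exact ⟨I, fun x hx => hVW (hIV fun i hi => by rw [hx i hi]; exact (hu i hi).2)⟩
  choose F hF using h
  obtain ⟨c, hc⟩ := exists_countable_free_coloring F
  refine ⟨Set.range fun k i => decide (c i = k), Set.countable_range _, fun a =>
    ⟨_, hF a _ fun i hi => ?_, ⟨c a, rfl⟩⟩⟩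
  by_cases hia : i = a
  · simp [zpt, hia]
  · simp [zpt, hia, hc a i hi hia]

/-- A countably compact set is covered by the star of a finite subset, for every open cover. -/
theorem IsCountablyCompact.exists_finite_star {X : Type*} [TopologicalSpace X] {K : Set X}
    (hK : IsCountablyCompact K) {𝒰 : Set (Set X)} (ho : ∀ U ∈ 𝒰, IsOpen U) (hcov : K ⊆ ⋃₀ 𝒰) :
    ∃ A ⊆ K, A.Finite ∧ K ⊆ ⋃₀ {U ∈ 𝒰 | (U ∩ A).Nonempty} := by
  by_contra! h
  obtain ⟨f, hfK, hf⟩ := exists_seq_of_forall_finset_exists (· ∈ K)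
    (fun x y => ∀ U ∈ 𝒰, x ∈ U → y ∉ U) fun s hs => by
      obtain ⟨y, hyK, hy⟩ := Set.not_subset.1 (h s hs s.finite_toSet)
      exact ⟨y, hyK, fun x hx U hU hxU hyU => hy ⟨U, ⟨hU, x, hxU, hx⟩, hyU⟩⟩
  obtain ⟨a, haK, ha⟩ := isCountablyCompact_iff_seq_clusterPt.1 hK f (.of_forall hfK)
  obtain ⟨U, hU, haU⟩ := hcov haK
  have hfreq := mapClusterPt_iff_frequently.1 ha U ((ho U hU).mem_nhds haU)
  obtain ⟨m, hm⟩ := hfreq.exists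
  obtain ⟨n, hmn, hn⟩ := Filter.frequently_atTop'.1 hfreq m
  exact hf m n hmn U hU hm hn

/-- If `κ` has uncountable cofinality, then the part of `X` below level `κ` is countably compact. -/
theorem isCountablyCompact_Xset_below (ι : Type u) {κ : Ordinal.{u}} (hκ : ℵ₀ < κ.cof) :
    IsCountablyCompact {p : ↥(Xset ι κ) | (p.1.2 : Ordinal) < κ} := by
  rw [Topology.IsEmbedding.subtypeVal.isCountablyCompact_iff,
    (Topology.IsEmbedding.id.prodMap Topology.IsEmbedding.subtypeVal).isCountablyCompact_iff]
  have himage : Prod.map id Subtype.val '' (Subtype.val ''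
      {p : ↥(Xset ι κ) | (p.1.2 : Ordinal) < κ}) = {p : (ι → Bool) × Ordinal.{u} | p.2 < κ} := by
    ext ⟨x, o⟩
    constructor
    · rintro ⟨_, ⟨p, hp, rfl⟩, hpx⟩
      obtain ⟨-, rfl⟩ := Prod.mk.inj hpx
      exact hp
    · intro ho
      exact ⟨_, ⟨⟨(x, ⟨o, Set.mem_Iic.2 (le_of_lt ho)⟩), fun h => absurd h (ne_of_lt ho)⟩, ho, rfl⟩, rfl⟩
  rw [himage]
  refine isCountablyCompact_iff_seq_clusterPt.2 fun x hx => ?_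
  have hpos : 0 < κ := Ordinal.cof_pos.1 (aleph0_pos.trans hκ)
  let y : ℕ → Ordinal.{u} := fun n => if (x n).2 < κ then (x n).2 else 0
  have hy : ⨆ n, y n < κ := by
    refine Ordinal.lift_iSup_lt_of_lt_cof (by simpa using hκ) fun n => ?_
    dsimp only [y]
    split_ifs with h
    exacts [h, hpos]
  have hK : IsCompact ((Set.univ : Set (ι → Bool)) ×ˢ Set.Icc 0 (⨆ n, y n)) :=
    isCompact_univ.prod isCompact_Icc
  obtain ⟨a, haK, ha⟩ := isCountablyCompact_iff_seq_clusterPt.1 hK.isCountablyCompact x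
    (hx.mono fun n hn => ⟨trivial, zero_le, by
      have := Ordinal.le_iSup y n
      rwa [show y n = (x n).2 from if_pos hn] at this⟩)
  exact ⟨a, haK.2.2.trans_lt hy, ha⟩

/-- With `τ` infinite and `cf(κ) > τ`, the space
`X = (D^τ × [0,κ]) \ ((D^τ \ Z) × {κ})` is star-Lindelöf: every open cover `𝒰` of `X` admits
a countable `A ⊆ X` with `St(A,𝒰) = X`. -/
theorem X_star_lindelof
    (τ : Cardinal.{u}) (hτ : ℵ₀ ≤ τ) (κ : Ordinal.{u}) (hκ : τ < κ.cof)
    (ι : Type u) (hι : #ι = τ) :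
    ∀ 𝒰 : Set (Set ↥(Xset ι κ)), (∀ U ∈ 𝒰, IsOpen U) → ⋃₀ 𝒰 = Set.univ →
      ∃ A : Set ↥(Xset ι κ), A.Countable ∧
        ⋃₀ {U ∈ 𝒰 | (U ∩ A).Nonempty} = Set.univ := by
  intro 𝒰 ho hcov
  obtain ⟨A, -, hAfin, hA⟩ := (isCountablyCompact_Xset_below ι (hτ.trans_lt hκ)).exists_finite_star
    ho (hcov ▸ Set.subset_univ _)
  have hlim : Order.IsSuccLimit κ :=
    Ordinal.one_lt_cof_iff.1 (one_lt_aleph0.trans_le (hτ.trans hκ.le))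
  have hpt (a : ι) : ((zpt a, ⟨κ, Set.mem_Iic.2 le_rfl⟩) : (ι → Bool) × ↥(Set.Iic κ)) ∈ Xset ι κ :=
    fun _ => ⟨a, rfl⟩
  have hnhd (a : ι) : ∃ U ∈ 𝒰, (⟨_, hpt a⟩ : ↥(Xset ι κ)) ∈ U ∧ ∃ W ∈ nhds (zpt a), ∃ l < κ,
      ∀ p : ↥(Xset ι κ), p.1.1 ∈ W → l < p.1.2 → p ∈ U := by
    obtain ⟨U, hU, haU⟩ : (⟨_, hpt a⟩ : ↥(Xset ι κ)) ∈ ⋃₀ 𝒰 := hcov ▸ Set.mem_univ _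
    refine ⟨U, hU, haU, ?_⟩
    have hmem := (ho U hU).mem_nhds haU
    rw [nhds_subtype_eq_comap, Filter.mem_comap] at hmem
    obtain ⟨V, hV, hVU⟩ := hmem
    obtain ⟨W, hW, T, hT, hWT⟩ := mem_nhds_prod_iff.1 hV
    rw [nhds_subtype_eq_comap, Filter.mem_comap] at hT
    obtain ⟨T', hT', hTT'⟩ := hT
    obtain ⟨l, hl, hlT⟩ := exists_Ioc_subset_of_mem_nhds hT' ⟨0, hlim.bot_lt⟩
    exact ⟨W, hW, l, hl, fun p hpW hlp => hVU (hWT ⟨hpW, hTT' (hlT ⟨hlp, p.1.2.2⟩)⟩)⟩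
  choose U hU haU W hW l hl hWU using hnhd
  obtain ⟨C, hC, hCW⟩ := exists_countable_meeting_nhds_zpt W hW
  have hδ : ⨆ a, l a + 1 < κ := Ordinal.iSup_add_one_lt_of_lt_cof (hι ▸ hκ) hl
  let e : (ι → Bool) → ↥(Xset ι κ) := fun x =>
    ⟨(x, ⟨⨆ a, l a + 1, hδ.le⟩), fun h => absurd h hδ.ne⟩
  refine ⟨A ∪ e '' C, hAfin.countable.union (hC.image e), Set.eq_univ_of_forall fun p => ?_⟩
  rcases (show (p.1.2 : Ordinal) ≤ κ from p.1.2.2).lt_or_eq with hp | hp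
  · obtain ⟨V, ⟨hV, hVA⟩, hpV⟩ := hA hp
    exact ⟨V, ⟨hV, hVA.mono (Set.inter_subset_inter_right _ Set.subset_union_left)⟩, hpV⟩
  · obtain ⟨a, ha⟩ := p.2 hp
    have hpa : p = ⟨_, hpt a⟩ := Subtype.ext (Prod.ext ha.symm (Subtype.ext hp))
    obtain ⟨x, hxW, hxC⟩ := hCW a
    exact ⟨U a, ⟨hU a, e x, hWU a _ hxW (Ordinal.lt_iSup_add_one l a), Or.inr ⟨x, hxC, rfl⟩⟩,
      hpa ▸ haU a⟩
end
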